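/- Let G be a finite simple graph that is P_7-free, bull-free and diamond-free. Then χ(G) ≤ max{7, ω(G)}. -/

import Mathlib

open SimpleGraph

/-- `G` is `H`-free: no induced subgraph of `G` is isomorphic to `H`. -/
def IsIndFree {V W : Type*} (G : SimpleGraph V) (H : SimpleGraph W) : Prop :=
  ∀ s : Set V, ¬ Nonempty (H ≃g G.induce s)

/-- The bull: a triangle with two pendant edges at distinct vertices. -/
def bull : SimpleGraph (Fin 5) :=
  SimpleGraph.fromEdgeSet {s(0,1), s(1,2), s(0,2), s(1,3), s(2,4)}

/-- The diamond: `K₄` minus an edge. -/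
def diamond : SimpleGraph (Fin 4) :=
  SimpleGraph.fromEdgeSet {s(0,2), s(0,3), s(1,2), s(1,3), s(2,3)}

theorem IsIndFree.not_embedding {V W : Type*} {G : SimpleGraph V} {H : SimpleGraph W}
    (h : IsIndFree G H) (f : H ↪g G) : False :=
  h (Set.range f) ⟨⟨Equiv.ofInjective f f.injective, f.map_rel_iff⟩⟩

/-- Two distinct common neighbours of the ends of an edge are adjacent in a diamond-free graph. -/
theorem IsIndFree.adj_of_diamond {V : Type*} {G : SimpleGraph V} (h : IsIndFree G diamond)
    {x y p q : V} (hxy : G.Adj x y) (hxp : G.Adj x p) (hyp : G.Adj y p) (hxq : G.Adj x q)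
    (hyq : G.Adj y q) (hpq : p ≠ q) : G.Adj p q := by
  by_contra hn
  have hn' : ¬ G.Adj q p := fun h => hn h.symm
  refine h.not_embedding ⟨⟨![p, q, x, y], ?_⟩, ?_⟩
  · intro i j hij
    have := hxy.ne; have := hxp.ne; have := hyp.ne; have := hxq.ne; have := hyq.ne
    fin_cases i <;> fin_cases j <;> simp_all
  · intro i j
    change G.Adj (![p, q, x, y] i) (![p, q, x, y] j) ↔ _
    fin_cases i <;> fin_cases j <;>
      simp [diamond, hxy, hxp, hyp, hxq, hyq, hn, hn', hxy.symm, hxp.symm, hyp.symm, hxq.symm,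
        hyq.symm]

/-- In a bull-free graph, pendant neighbours of distinct vertices of a triangle are adjacent. -/
theorem IsIndFree.adj_of_bull {V : Type*} {G : SimpleGraph V} (h : IsIndFree G bull)
    {a b c x y : V} (hab : G.Adj a b) (hac : G.Adj a c) (hbc : G.Adj b c)
    (hax : G.Adj a x) (hby : G.Adj b y) (hbx : ¬ G.Adj b x) (hcx : ¬ G.Adj c x)
    (hay : ¬ G.Adj a y) (hcy : ¬ G.Adj c y) : G.Adj x y := by
  by_contra hn
  have h1 : ¬ G.Adj x b := fun h => hbx h.symm
  have h2 : ¬ G.Adj x c := fun h => hcx h.symm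
  have h3 : ¬ G.Adj y a := fun h => hay h.symm
  have h4 : ¬ G.Adj y c := fun h => hcy h.symm
  have h5 : ¬ G.Adj y x := fun h => hn h.symm
  refine h.not_embedding ⟨⟨![c, a, b, x, y], ?_⟩, ?_⟩
  · have := hab.ne; have := hac.ne; have := hbc.ne; have := hax.ne; have := hby.ne
    have : b ≠ x := fun e => h2 (e ▸ hbc)
    have : c ≠ x := fun e => hbx (e ▸ hbc)
    have : a ≠ y := fun e => h4 (e ▸ hac)
    have : c ≠ y := fun e => hay (e ▸ hac)
    have : x ≠ y := fun e => hay (e ▸ hax)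
    intro i j hij
    fin_cases i <;> fin_cases j <;> simp_all
  · intro i j
    change G.Adj (![c, a, b, x, y] i) (![c, a, b, x, y] j) ↔ _
    fin_cases i <;> fin_cases j <;>
      simp [bull, hab, hac, hbc, hax, hby, hbx, hcx, hay, hcy, hn, h1, h2, h3, h4, h5, hab.symm,
        hac.symm, hbc.symm, hax.symm, hby.symm]

namespace SimpleGraph

variable {V : Type*} {G : SimpleGraph V}

/-- The subgraph induced on `S` has a proper colouring with the colours below `m`. -/
def ColorableOn (G : SimpleGraph V) (S : Finset V) (m : ℕ) : Prop :=
  ∃ c : V → ℕ, ∀ u ∈ S, c u < m ∧ ∀ w ∈ S, G.Adj u w → c u ≠ c w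

/-- `T` is a union of connected components of the subgraph induced on `R`. -/
def ClosedIn (G : SimpleGraph V) (T R : Finset V) : Prop :=
  T ⊆ R ∧ ∀ x ∈ T, ∀ y ∈ R, G.Adj x y → y ∈ T

/-- The subgraph induced on `C` has at most one connected component. -/
def ConnectedOn (G : SimpleGraph V) (C : Finset V) : Prop :=
  ∀ T, G.ClosedIn T C → T.Nonempty → T = C

theorem ColorableOn.mono {S : Finset V} {m n : ℕ} (h : G.ColorableOn S m) (hmn : m ≤ n) :
    G.ColorableOn S n := by
  obtain ⟨c, hc⟩ := h
  exact ⟨c, fun u hu => ⟨(hc u hu).1.trans_le hmn, (hc u hu).2⟩⟩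

theorem nonempty_of_not_colorableOn {S : Finset V} {m : ℕ} (h : ¬ G.ColorableOn S m) :
    S.Nonempty := by
  rw [Finset.nonempty_iff_ne_empty]
  rintro rfl
  exact h ⟨fun _ => 0, by simp⟩

open Classical in
/-- Colouring a stable set with one new colour. -/
theorem ColorableOn.of_sdiff_stable {S N : Finset V} {m : ℕ} (h : G.ColorableOn (S \ N) m)
    (hN : ∀ u ∈ S, ∀ w ∈ S, u ∈ N → w ∈ N → ¬ G.Adj u w) : G.ColorableOn S (m + 1) := by
  obtain ⟨c, hc⟩ := h
  refine ⟨fun x => if x ∈ N then m else c x, fun u hu => ?_⟩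
  by_cases huN : u ∈ N
  · refine ⟨by simp [huN], fun w hw huw => ?_⟩
    have hwN : w ∉ N := fun hwN => hN u hu w hw huN hwN huw
    have := (hc w (by simp [hw, hwN])).1
    simp only [huN, hwN, if_true, if_false]
    omega
  · have h1 := hc u (by simp [hu, huN])
    refine ⟨by simp only [huN, if_false]; omega, fun w hw huw => ?_⟩
    by_cases hwN : w ∈ N
    · simp only [huN, hwN, if_true, if_false]
      omega
    · simpa only [huN, hwN, if_false] using h1.2 w (by simp [hw, hwN]) huw

open Classical in
theorem ColorableOn.of_closedIn {S T : Finset V} {m : ℕ} (hT : G.ClosedIn T S)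
    (h₁ : G.ColorableOn T m) (h₂ : G.ColorableOn (S \ T) m) : G.ColorableOn S m := by
  obtain ⟨c, hc⟩ := h₁
  obtain ⟨d, hd⟩ := h₂
  refine ⟨fun x => if x ∈ T then c x else d x, fun u hu => ?_⟩
  by_cases huT : u ∈ T
  · refine ⟨by simpa [huT] using (hc u huT).1, fun w hw huw => ?_⟩
    have hwT := hT.2 u huT w hw huw
    simpa [huT, hwT] using (hc u huT).2 w hwT huw
  · have huS : u ∈ S \ T := by simp [hu, huT]
    refine ⟨by simpa [huT] using (hd u huS).1, fun w hw huw => ?_⟩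
    have hwT : w ∉ T := fun hwT => huT (hT.2 w hwT u hu huw.symm)
    simpa [huT, hwT] using (hd u huS).2 w (by simp [hw, hwT]) huw

open Classical in
/-- Some connected component is as hard to colour as the whole graph. -/
theorem exists_connectedOn_not_colorableOn {R : Finset V} {m : ℕ} (h : ¬ G.ColorableOn R m) :
    ∃ C, G.ClosedIn C R ∧ G.ConnectedOn C ∧ ¬ G.ColorableOn C m := by
  let F := R.powerset.filter fun C => G.ClosedIn C R ∧ ¬ G.ColorableOn C m
  have hF : F.Nonempty :=
    ⟨R, by simp only [F, Finset.mem_filter, Finset.mem_powerset]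
           exact ⟨subset_rfl, ⟨subset_rfl, fun _ _ _ hy _ => hy⟩, h⟩⟩
  obtain ⟨C, hCF, hmin⟩ := F.exists_min_image Finset.card hF
  simp only [F, Finset.mem_filter, Finset.mem_powerset] at hCF hmin
  obtain ⟨hCR, hC, hCm⟩ := hCF
  refine ⟨C, hC, fun T hT hTne => ?_, hCm⟩
  by_contra hne
  have hTlt : T.card < C.card := Finset.card_lt_card (hT.1.ssubset_of_ne hne)
  have hDlt : (C \ T).card < C.card := by
    rw [Finset.card_sdiff_of_subset hT.1]
    have := hTne.card_pos
    omega
  have hTR : G.ClosedIn T R :=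
    ⟨hT.1.trans hCR, fun x hx y hy hxy => hT.2 x hx y (hC.2 x (hT.1 hx) y hy hxy) hxy⟩
  have hDR : G.ClosedIn (C \ T) R := by
    refine ⟨Finset.sdiff_subset.trans hCR, fun x hx y hy hxy => ?_⟩
    rw [Finset.mem_sdiff] at hx ⊢
    exact ⟨hC.2 x hx.1 y hy hxy, fun hyT => hx.2 (hT.2 y hyT x hx.1 hxy.symm)⟩
  refine hCm (ColorableOn.of_closedIn hT ?_ ?_)
  · by_contra hTm
    exact absurd (hmin T ⟨hTR.1, hTR, hTm⟩) (by omega)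
  · by_contra hDm
    exact absurd (hmin _ ⟨hDR.1, hDR, hDm⟩) (by omega)

open Classical in
/-- Gyárfás path argument: a vertex attached to a connected triangle-free graph of large chromatic
number starts a long induced path. -/
theorem exists_induced_path_of_not_colorableOn (n : ℕ) :
    ∀ (C : Finset V) (v : V),
      (∀ x ∈ insert v C, ∀ y ∈ insert v C, ∀ z ∈ insert v C,
        G.Adj x y → G.Adj x z → ¬ G.Adj y z) →
      v ∉ C → (∃ u ∈ C, G.Adj v u) → G.ConnectedOn C → ¬ G.ColorableOn C n →
      ∃ p : ℕ → V, p 0 = v ∧ (∀ i ≤ n, p i ∈ insert v C) ∧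
        (∀ i ≤ n, ∀ j ≤ n, p i = p j → i = j) ∧
        ∀ i ≤ n, ∀ j ≤ n, (G.Adj (p i) (p j) ↔ i + 1 = j ∨ j + 1 = i) := by
  induction n with
  | zero =>
    intro C v _ _ _ _ _
    refine ⟨fun _ => v, rfl, by simp, by omega, fun i hi j hj => ?_⟩
    simp only [SimpleGraph.irrefl, false_iff]
    omega
  | succ n ih =>
    intro C v htri hvC ⟨w, hwC, hvw⟩ hC hCn
    have hR : ¬ G.ColorableOn (C \ C.filter (G.Adj v)) n := by
      refine fun h => hCn (h.of_sdiff_stable fun x hx y hy hxN hyN => ?_)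
      exact htri v (by simp) x (by simp [hx]) y (by simp [hy])
        (Finset.mem_filter.1 hxN).2 (Finset.mem_filter.1 hyN).2
    obtain ⟨D, hDR, hD, hDn⟩ := exists_connectedOn_not_colorableOn hR
    have hDC : D ⊆ C := hDR.1.trans Finset.sdiff_subset
    have hvD : ∀ x ∈ D, ¬ G.Adj v x := fun x hx hvx => by
      have := hDR.1 hx
      simp only [Finset.mem_sdiff, Finset.mem_filter, not_and] at this
      exact this.2 this.1 hvx
    obtain ⟨u, huC, hvu, huD⟩ : ∃ u ∈ C, G.Adj v u ∧ ∃ x ∈ D, G.Adj u x := by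
      by_contra! hcon
      have hcl : G.ClosedIn D C := by
        refine ⟨hDC, fun x hx y hy hxy => hDR.2 x hx y ?_ hxy⟩
        simp only [Finset.mem_sdiff, Finset.mem_filter, not_and]
        exact ⟨hy, fun _ hvy => hcon y hy hvy x hx hxy.symm⟩
      have := hC D hcl (nonempty_of_not_colorableOn hDn)
      exact hvD w (this ▸ hwC) hvw
    have hsub : ∀ x ∈ insert u D, x ∈ C := by
      intro x hx
      rcases Finset.mem_insert.1 hx with rfl | hx
      exacts [huC, hDC hx]
    obtain ⟨p, hp0, hpm, hpi, hpa⟩ := ih D u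
      (fun x hx y hy z hz => htri x (Finset.mem_insert_of_mem (hsub x hx)) y
        (Finset.mem_insert_of_mem (hsub y hy)) z (Finset.mem_insert_of_mem (hsub z hz)))
      (fun h => hvD u h hvu) huD hD hDn
    have hne : ∀ i ≤ n, v ≠ p i := fun i hi h => hvC (h ▸ hsub _ (hpm i hi))
    have hva : ∀ i ≤ n, (G.Adj v (p i) ↔ i = 0) := by
      intro i hi
      refine ⟨fun h => ?_, fun h => by rw [h, hp0]; exact hvu⟩
      rcases Finset.mem_insert.1 (hpm i hi) with hu | hx
      · exact hpi i hi 0 (by omega) (hu.trans hp0.symm)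
      · exact absurd h (hvD _ hx)
    refine ⟨fun i => Nat.casesOn i v p, rfl, ?_, ?_, ?_⟩
    · rintro (_ | i) hi
      · simp
      · exact Finset.mem_insert_of_mem (hsub _ (hpm i (by omega)))
    · rintro (_ | i) hi (_ | j) hj h
      · rfl
      · exact absurd h (hne j (by omega))
      · exact absurd h.symm (hne i (by omega))
      · exact congrArg _ (hpi i (by omega) j (by omega) h)
    · rintro (_ | i) hi (_ | j) hj
      · simp
      · simpa [eq_comm] using hva j (by omega)
      · simpa [G.adj_comm _ v, eq_comm] using hva i (by omega)
      · simpa using hpa i (by omega) j (by omega)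

open Classical in
/-- A triangle-free graph without an induced path on `n + 1` vertices is `n + 1`-colourable. -/
theorem colorableOn_of_triangleFree_of_isIndFree_pathGraph {n : ℕ}
    (hP : IsIndFree G (pathGraph (n + 1))) {S : Finset V}
    (htri : ∀ x ∈ S, ∀ y ∈ S, ∀ z ∈ S, G.Adj x y → G.Adj x z → ¬ G.Adj y z) :
    G.ColorableOn S (n + 1) := by
  by_contra hS
  obtain ⟨C, hCS, hC, hCn⟩ := exists_connectedOn_not_colorableOn hS
  obtain ⟨v, hv⟩ := nonempty_of_not_colorableOn hCn
  have hR : ¬ G.ColorableOn (C \ {v}) n := by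
    refine fun h => hCn (h.of_sdiff_stable fun x _ y _ hx hy => ?_)
    rw [Finset.mem_singleton.1 hx, Finset.mem_singleton.1 hy]
    exact G.irrefl
  obtain ⟨D, hDR, hD, hDn⟩ := exists_connectedOn_not_colorableOn hR
  have hDC : D ⊆ C := hDR.1.trans Finset.sdiff_subset
  have hvD : v ∉ D := fun h => by simpa using hDR.1 h
  have hvu : ∃ u ∈ D, G.Adj v u := by
    by_contra! hcon
    have hcl : G.ClosedIn D C := by
      refine ⟨hDC, fun x hx y hy hxy => hDR.2 x hx y ?_ hxy⟩
      rw [Finset.mem_sdiff, Finset.mem_singleton]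
      exact ⟨hy, fun h => hcon x hx (h ▸ hxy.symm)⟩
    exact hvD (hC D hcl (nonempty_of_not_colorableOn hDn) ▸ hv)
  have hsub : ∀ x ∈ insert v D, x ∈ S := by
    intro x hx
    rcases Finset.mem_insert.1 hx with rfl | hx
    exacts [hCS.1 hv, hCS.1 (hDC hx)]
  obtain ⟨p, -, -, hpi, hpa⟩ := exists_induced_path_of_not_colorableOn n D v
    (fun x hx y hy z hz => htri x (hsub x hx) y (hsub y hy) z (hsub z hz)) hvD hvu hD hDn
  refine hP.not_embedding ⟨⟨fun i => p i, fun i j h => Fin.ext ?_⟩, fun {i j} => ?_⟩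
  · exact hpi i (by omega) j (by omega) h
  · rw [pathGraph_adj]
    exact hpa i (by omega) j (by omega)

open Classical in
/-- A colouring extends to a vertex with fewer neighbours than there are colours. -/
theorem ColorableOn.of_erase {S : Finset V} {k : ℕ} {v : V} (h : G.ColorableOn (S.erase v) k)
    (hdeg : (S.filter (G.Adj v)).card < k) : G.ColorableOn S k := by
  obtain ⟨c, hc⟩ := h
  obtain ⟨i, hi, hiN⟩ : ∃ i ∈ Finset.range k, i ∉ (S.filter (G.Adj v)).image c :=
    Finset.exists_mem_notMem_of_card_lt_card
      (Finset.card_image_le.trans_lt (by simpa using hdeg))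
  have hfree : ∀ w ∈ S, G.Adj v w → c w ≠ i := fun w hw hvw e =>
    hiN (Finset.mem_image.2 ⟨w, Finset.mem_filter.2 ⟨hw, hvw⟩, e⟩)
  refine ⟨Function.update c v i, fun u hu => ?_⟩
  by_cases huv : u = v
  · subst huv
    refine ⟨by simpa using hi, fun w hw huw => ?_⟩
    simpa [Function.update_of_ne huw.ne'] using (hfree w hw huw).symm
  · have h1 := hc u (Finset.mem_erase.2 ⟨huv, hu⟩)
    refine ⟨by simpa [huv] using h1.1, fun w hw huw => ?_⟩
    by_cases hwv : w = v
    · subst hwv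
      simpa [huv] using hfree u hu huw.symm
    · simpa [huv, hwv] using h1.2 w (Finset.mem_erase.2 ⟨hwv, hw⟩) huw

open Classical in
/-- If every vertex `a` of a nontrivial clique `K` has a single neighbour `π a` outside `K`, and
these neighbours form a clique, then colourings extend to `K`. -/
theorem ColorableOn.of_sdiff_clique [Fintype V] {S K : Finset V} {k : ℕ} {π : V → V}
    (h : G.ColorableOn (S \ K) k) (hK : K.Nontrivial) (hπS : ∀ a ∈ K, π a ∈ S \ K)
    (hπ : ∀ a ∈ K, ∀ x ∈ S \ K, G.Adj a x → x = π a)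
    (hadj : ∀ a ∈ K, ∀ b ∈ K, a ≠ b → G.Adj (π a) (π b)) : G.ColorableOn S k := by
  obtain ⟨c, hc⟩ := h
  obtain ⟨σ, hσ, -⟩ := K.exists_cycleOn
  have hσK : ∀ a ∈ K, σ a ∈ K := fun a ha => hσ.1.mapsTo ha
  have hσne : ∀ a ∈ K, σ a ≠ a := fun a ha => hσ.apply_ne hK ha
  have hcol : ∀ a ∈ K, ∀ b ∈ K, a ≠ b → c (π a) ≠ c (π b) := fun a ha b hb hab =>
    (hc _ (hπS a ha)).2 _ (hπS b hb) (hadj a ha b hb hab)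
  have hcross : ∀ a ∈ K, ∀ x ∈ S, x ∉ K → G.Adj a x → c (π (σ a)) ≠ c x := by
    intro a ha x hx hxK hax
    rw [hπ a ha x (Finset.mem_sdiff.2 ⟨hx, hxK⟩) hax]
    exact hcol _ (hσK a ha) _ ha (hσne a ha)
  refine ⟨fun x => if x ∈ K then c (π (σ x)) else c x, fun u hu => ?_⟩
  by_cases huK : u ∈ K
  · refine ⟨by simpa [huK] using (hc _ (hπS _ (hσK u huK))).1, fun w hw huw => ?_⟩
    by_cases hwK : w ∈ K
    · simpa [huK, hwK] using
        hcol _ (hσK u huK) _ (hσK w hwK) (fun e => huw.ne (σ.injective e))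
    · simpa [huK, hwK] using hcross u huK w hw hwK huw
  · have h1 := hc u (Finset.mem_sdiff.2 ⟨hu, huK⟩)
    refine ⟨by simpa [huK] using h1.1, fun w hw huw => ?_⟩
    by_cases hwK : w ∈ K
    · simpa [huK, hwK] using (hcross w hwK u hu huK huw.symm).symm
    · simpa [huK, hwK] using h1.2 w (Finset.mem_sdiff.2 ⟨hw, hwK⟩) huw

open Classical in
/-- A maximum clique with at least three vertices can be removed when all degrees are large. -/
theorem ColorableOn.of_sdiff_maximum_clique [Fintype V] (hb : IsIndFree G bull)
    (hd : IsIndFree G diamond)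
    {S K : Finset V} {k : ℕ} (hKS : K ⊆ S) (hK : G.IsClique K) (hcard : 3 ≤ K.card)
    (hmax : ∀ L ⊆ S, G.IsClique L → L.card ≤ K.card) (hKk : K.card ≤ k)
    (hdeg : ∀ v ∈ S, k ≤ (S.filter (G.Adj v)).card) (h : G.ColorableOn (S \ K) k) :
    G.ColorableOn S k := by
  have huniq : ∀ x ∈ S \ K, ∀ a ∈ K, ∀ b ∈ K, G.Adj a x → G.Adj b x → a = b := by
    intro x hx a ha b hb' hax hbx
    rw [Finset.mem_sdiff] at hx
    by_contra hab
    have hall : ∀ c ∈ K, G.Adj x c := by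
      intro c hc
      by_cases hca : c = a
      · exact hca ▸ hax.symm
      by_cases hcb : c = b
      · exact hcb ▸ hbx.symm
      exact hd.adj_of_diamond (hK ha hb' hab) hax hbx (hK ha hc (Ne.symm hca))
        (hK hb' hc (Ne.symm hcb)) (fun e => hx.2 (e ▸ hc))
    have := hmax (insert x K) (Finset.insert_subset hx.1 hKS) (by
      rw [Finset.coe_insert, isClique_insert]
      exact ⟨hK, fun c hc _ => hall c hc⟩)
    rw [Finset.card_insert_of_notMem hx.2] at this
    omega
  have hex : ∀ a, ∃ y, a ∈ K → y ∈ S \ K ∧ G.Adj a y := by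
    intro a
    by_cases ha : a ∈ K
    · have hlt : (K.erase a).card < (S.filter (G.Adj a)).card := by
        have := hdeg a (hKS ha)
        rw [Finset.card_erase_of_mem ha]
        omega
      obtain ⟨y, hy, hyK⟩ := Finset.exists_mem_notMem_of_card_lt_card hlt
      rw [Finset.mem_filter] at hy
      refine ⟨y, fun _ => ⟨Finset.mem_sdiff.2 ⟨hy.1, fun h => hyK ?_⟩, hy.2⟩⟩
      exact Finset.mem_erase.2 ⟨hy.2.ne', h⟩
    · exact ⟨a, fun h => absurd h ha⟩
  choose π hπ using hex
  have hthird : ∀ a b : V, ∃ c ∈ K, c ≠ a ∧ c ≠ b := by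
    intro a b
    obtain ⟨c, hc, hcab⟩ := Finset.exists_mem_notMem_of_card_lt_card
      ((Finset.card_le_two (a := a) (b := b)).trans_lt hcard)
    simp only [Finset.mem_insert, Finset.mem_singleton, not_or] at hcab
    exact ⟨c, hc, hcab⟩
  have hadj : ∀ a ∈ K, ∀ b ∈ K, a ≠ b → ∀ x ∈ S \ K, ∀ y ∈ S \ K,
      G.Adj a x → G.Adj b y → G.Adj x y := by
    intro a ha b hb' hab x hx y hy hax hby
    obtain ⟨c, hc, hca, hcb⟩ := hthird a b
    exact hb.adj_of_bull (hK ha hb' hab) (hK ha hc hca.symm) (hK hb' hc hcb.symm) hax hby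
      (fun h => hab (huniq x hx a ha b hb' hax h)) (fun h => hca (huniq x hx c hc a ha h hax))
      (fun h => hab (huniq y hy a ha b hb' h hby)) (fun h => hcb (huniq y hy c hc b hb' h hby))
  refine h.of_sdiff_clique (π := π) (Finset.one_lt_card_iff_nontrivial.1 (by omega))
    (fun a ha => (hπ a ha).1) (fun a ha x hx hax => ?_)
    (fun a ha b hb' hab => hadj a ha b hb' hab _ (hπ a ha).1 _ (hπ b hb').1 (hπ a ha).2
      (hπ b hb').2)
  by_contra hne
  obtain ⟨b, hbK, hba, -⟩ := hthird a a
  obtain ⟨c, hcK, hca, hcb⟩ := hthird a b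
  obtain ⟨hyS, hby⟩ := hπ b hbK
  obtain ⟨hzS, hcz⟩ := hπ c hcK
  obtain ⟨hwS, haw⟩ := hπ a ha
  have hxy := hadj a ha b hbK hba.symm x hx _ hyS hax hby
  have hwy := hadj a ha b hbK hba.symm _ hwS _ hyS haw hby
  have hxz := hadj a ha c hcK hca.symm x hx _ hzS hax hcz
  have hwz := hadj a ha c hcK hca.symm _ hwS _ hzS haw hcz
  have hyz := hadj b hbK c hcK hcb.symm _ hyS _ hzS hby hcz
  have hxw := hd.adj_of_diamond hyz hxy.symm hxz.symm hwy.symm hwz.symm hne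
  have hay : G.Adj a (π b) := hd.adj_of_diamond hxw hax.symm haw.symm hxy hwy
    (fun e => (Finset.mem_sdiff.1 hyS).2 (e ▸ ha))
  exact hba (huniq _ hyS b hbK a ha hby hay)

open Classical in
theorem colorableOn_of_isIndFree [Fintype V] (hp : IsIndFree G (pathGraph 7))
    (hb : IsIndFree G bull) (hd : IsIndFree G diamond) (S : Finset V) :
    G.ColorableOn S (max 7 G.cliqueNum) := by
  induction S using Finset.strongInduction with
  | H S ih =>
  by_cases hdeg : ∃ v ∈ S, (S.filter (G.Adj v)).card < max 7 G.cliqueNum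
  · obtain ⟨v, hv, hlt⟩ := hdeg
    exact (ih _ (Finset.erase_ssubset hv)).of_erase hlt
  push Not at hdeg
  by_cases htri : ∀ x ∈ S, ∀ y ∈ S, ∀ z ∈ S, G.Adj x y → G.Adj x z → ¬ G.Adj y z
  · exact (colorableOn_of_triangleFree_of_isIndFree_pathGraph hp htri).mono (le_max_left _ _)
  push Not at htri
  obtain ⟨x, hx, y, hy, z, hz, hxy, hxz, hyz⟩ := htri
  let F := S.powerset.filter fun L : Finset V => G.IsClique (L : Set V)
  have hT : {x, y, z} ∈ F := by
    simp only [F, Finset.mem_filter, Finset.mem_powerset]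
    refine ⟨by simp [Finset.insert_subset_iff, hx, hy, hz], ?_⟩
    exact (is3Clique_triple_iff.2 ⟨hxy, hxz, hyz⟩).isClique
  obtain ⟨K, hKF, hmax⟩ := F.exists_max_image Finset.card ⟨_, hT⟩
  have hcard : 3 ≤ K.card := by
    rw [← (is3Clique_triple_iff.2 ⟨hxy, hxz, hyz⟩).card_eq]
    exact hmax _ hT
  simp only [F, Finset.mem_filter, Finset.mem_powerset] at hKF hmax
  obtain ⟨hKS, hK⟩ := hKF
  refine ColorableOn.of_sdiff_maximum_clique hb hd hKS hK hcard
    (fun L hL hLc => hmax L ⟨hL, hLc⟩) (hK.card_le_cliqueNum.trans (le_max_right _ _)) hdeg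
    (ih _ (Finset.sdiff_ssubset hKS ?_))
  exact Finset.card_pos.1 (by omega)

end SimpleGraph

theorem statement_10 {V : Type*} [Fintype V] (G : SimpleGraph V)
    (hGp : IsIndFree G (pathGraph 7)) (hGb : IsIndFree G bull)
    (hGd : IsIndFree G diamond) :
    G.chromaticNumber ≤ (max 7 G.cliqueNum : ℕ∞) := by
  obtain ⟨c, hc⟩ := colorableOn_of_isIndFree hGp hGb hGd Finset.univ
  have hcol : G.Colorable (max 7 G.cliqueNum) :=
    ⟨Coloring.mk (fun v => ⟨c v, (hc v (Finset.mem_univ v)).1⟩) fun {u w} huw e =>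
      (hc u (Finset.mem_univ u)).2 w (Finset.mem_univ w) huw (congrArg Fin.val e)⟩
  exact hcol.chromaticNumber_le.trans_eq rfl
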